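/- There exists a constant Ϝ_N depending only on N with the following property: defining, for 2 ≤ l ≤ N, S_l = {j ∈ ℤ : |j| > 2^N and |a_l| 2^{−jl} > Ϝ_N |a_i| 2^{−ji} for all i ≠ l with 2 ≤ i ≤ N}, the sets S_l are pairwise disjoint, and if the coefficients a_2, …, a_N are not all zero, then the complement S_o := ℤ \ ⋃_{l=2}^N S_l has cardinality bounded by a constant depending only on N. -/

import Mathlib

open Set

noncomputable section

/-- The set `S_l` of scales where the monomial `a_l t^l` dominates:
`S_l = {j ∈ ℤ : |j| > 2^N, |a_l| 2^{-jl} > Ϝ |a_i| 2^{-ji} for all i ≠ l, 2 ≤ i ≤ N}`. -/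
def domSet (N l : ℕ) (a : ℕ → ℝ) (Ϝ : ℝ) : Set ℤ :=
  {j : ℤ | (2 : ℤ) ^ N < |j| ∧
    ∀ i : ℕ, 2 ≤ i → i ≤ N → i ≠ l →
      Ϝ * (|a i| * (2 : ℝ) ^ (-(j * (i : ℤ)))) < |a l| * (2 : ℝ) ^ (-(j * (l : ℤ)))}

/-- Two nonzero monomials of different degrees have equal size at no more than one dyadic scale. -/
lemma eq_of_monomial_balance {b c : ℝ} {i l : ℕ} (hb : b ≠ 0) (hc : c ≠ 0) (hil : i ≠ l)
    {j k : ℤ}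
    (hj : b * (2 : ℝ) ^ (-(j * (i : ℤ))) = c * (2 : ℝ) ^ (-(j * (l : ℤ))))
    (hk : b * (2 : ℝ) ^ (-(k * (i : ℤ))) = c * (2 : ℝ) ^ (-(k * (l : ℤ)))) : j = k := by
  have h2 : (2 : ℝ) ≠ 0 := two_ne_zero
  have hpow : (2 : ℝ) ^ (-(j * (i : ℤ)) + -(k * (l : ℤ)))
      = (2 : ℝ) ^ (-(j * (l : ℤ)) + -(k * (i : ℤ))) := by
    rw [zpow_add₀ h2, zpow_add₀ h2]
    apply mul_left_cancel₀ (mul_ne_zero hb hc)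
    linear_combination (c * (2 : ℝ) ^ (-(k * (l : ℤ)))) * hj
      - (c * (2 : ℝ) ^ (-(j * (l : ℤ)))) * hk
  have hexp := zpow_right_injective₀ (by norm_num : (0 : ℝ) < 2) (by norm_num) hpow
  have hprod : (j - k) * ((i : ℤ) - l) = 0 := by linear_combination -hexp
  rcases mul_eq_zero.mp hprod with h | h
  · exact sub_eq_zero.mp h
  · exact absurd (by exact_mod_cast sub_eq_zero.mp h) hil

/-- The scales at which two distinct monomials `a_i t^i`, `a_l t^l` are nonzero and of equal
size. -/
def balanceSet (a : ℕ → ℝ) (i l : ℕ) : Set ℤ :=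
  {j : ℤ | i ≠ l ∧ a i ≠ 0 ∧ a l ≠ 0 ∧
    |a i| * (2 : ℝ) ^ (-(j * (i : ℤ))) = |a l| * (2 : ℝ) ^ (-(j * (l : ℤ)))}

lemma balanceSet_subsingleton (a : ℕ → ℝ) (i l : ℕ) : (balanceSet a i l).Subsingleton := by
  rintro j ⟨hil, hi, hl, hj⟩ k ⟨-, -, -, hk⟩
  exact eq_of_monomial_balance (abs_ne_zero.mpr hi) (abs_ne_zero.mpr hl) hil hj hk

/-- A large scale at which no monomial strictly dominates balances two of them. -/
lemma exists_mem_balanceSet {N : ℕ} {a : ℕ → ℝ} (ha : ∃ i : ℕ, 2 ≤ i ∧ i ≤ N ∧ a i ≠ 0)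
    {j : ℤ} (hj : (2 : ℤ) ^ N < |j|)
    (h : ∀ l : ℕ, 2 ≤ l → l ≤ N → j ∉ domSet N l a 1) :
    ∃ i ≤ N, ∃ l ≤ N, j ∈ balanceSet a i l := by
  obtain ⟨m, hm2, hmN, hm⟩ := ha
  obtain ⟨l, hl, hmax⟩ := Finset.exists_max_image (Finset.Icc 2 N)
    (fun i : ℕ => |a i| * (2 : ℝ) ^ (-(j * (i : ℤ)))) ⟨m, Finset.mem_Icc.mpr ⟨hm2, hmN⟩⟩
  rw [Finset.mem_Icc] at hl
  have hpos : 0 < |a l| * (2 : ℝ) ^ (-(j * (l : ℤ))) :=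
    (mul_pos (abs_pos.mpr hm) (by positivity)).trans_le
      (hmax m (Finset.mem_Icc.mpr ⟨hm2, hmN⟩))
  have hnot := h l hl.1 hl.2
  simp only [domSet, Set.mem_ofPred_eq, not_and, one_mul] at hnot
  have hex := hnot hj
  push Not at hex
  obtain ⟨i, hi2, hiN, hil, hle⟩ := hex
  have heq := le_antisymm (hmax i (Finset.mem_Icc.mpr ⟨hi2, hiN⟩)) hle
  refine ⟨i, hiN, l, hl.2, hil, ?_, ?_, heq⟩
  · intro h0
    simp only [h0, abs_zero, zero_mul] at heq
    exact hpos.ne heq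
  · intro h0
    simp [h0] at hpos

/-- There is a constant `Ϝ_N` depending only on `N` such that the sets `S_l`
(`2 ≤ l ≤ N`) are pairwise disjoint, and whenever the coefficients are not all zero the
complement `S_o = ℤ \ ⋃_{l=2}^N S_l` has cardinality bounded by a constant depending only
on `N`. -/
theorem dominating_sets_disjoint_and_small_complement (N : ℕ) (hN : 2 ≤ N) :
    ∃ (Ϝ : ℝ) (C : ℕ), 0 < Ϝ ∧
      ∀ a : ℕ → ℝ,
        (∀ l l' : ℕ, 2 ≤ l → l ≤ N → 2 ≤ l' → l' ≤ N → l ≠ l' →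
          domSet N l a Ϝ ∩ domSet N l' a Ϝ = ∅) ∧
        ((∃ i : ℕ, 2 ≤ i ∧ i ≤ N ∧ a i ≠ 0) →
          ({j : ℤ | ∀ l : ℕ, 2 ≤ l → l ≤ N → j ∉ domSet N l a Ϝ}.Finite ∧
            {j : ℤ | ∀ l : ℕ, 2 ≤ l → l ≤ N → j ∉ domSet N l a Ϝ}.ncard ≤ C)) := by
  refine ⟨1, (Finset.Icc (-(2 : ℤ) ^ N) (2 ^ N)).card + (N + 1) * (N + 1), one_pos,
    fun a => ⟨fun l l' hl2 hlN hl2' hlN' hne => ?_, fun ha => ?_⟩⟩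
  · refine Set.eq_empty_of_forall_notMem ?_
    rintro j ⟨⟨-, h⟩, ⟨-, h'⟩⟩
    have h₁ := h l' hl2' hlN' hne.symm
    have h₂ := h' l hl2 hlN hne
    rw [one_mul] at h₁ h₂
    exact lt_asymm h₁ h₂
  · classical
    let B : ℕ × ℕ → Finset ℤ := fun p => (balanceSet_subsingleton a p.1 p.2).finite.toFinset
    let T : Finset ℤ := Finset.Icc (-(2 : ℤ) ^ N) (2 ^ N) ∪
      (Finset.range (N + 1) ×ˢ Finset.range (N + 1)).biUnion B
    have hsub : {j : ℤ | ∀ l : ℕ, 2 ≤ l → l ≤ N → j ∉ domSet N l a 1} ⊆ (T : Set ℤ) := by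
      intro j hj
      rw [Finset.mem_coe, Finset.mem_union]
      rcases le_or_gt |j| ((2 : ℤ) ^ N) with hsmall | hlarge
      · exact Or.inl (Finset.mem_Icc.mpr (abs_le.mp hsmall))
      · obtain ⟨i, hi, l, hl, hmem⟩ := exists_mem_balanceSet ha hlarge hj
        refine Or.inr (Finset.mem_biUnion.mpr ⟨(i, l), ?_, ?_⟩)
        · simp only [Finset.mem_product, Finset.mem_range]
          omega
        · exact (Set.Finite.mem_toFinset _).mpr hmem
    have hB : ∀ p, (B p).card ≤ 1 := fun p => by
      rw [Finset.card_le_one]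
      intro x hx y hy
      exact balanceSet_subsingleton a p.1 p.2 ((Set.Finite.mem_toFinset _).mp hx)
        ((Set.Finite.mem_toFinset _).mp hy)
    refine ⟨T.finite_toSet.subset hsub, ?_⟩
    calc _ ≤ (T : Set ℤ).ncard := Set.ncard_le_ncard hsub T.finite_toSet
      _ = T.card := Set.ncard_coe_finset T
      _ ≤ _ := (Finset.card_union_le _ _).trans (Nat.add_le_add_left ?_ _)
    refine (Finset.card_biUnion_le_card_mul _ _ 1 fun p _ => hB p).trans ?_
    simp
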